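/- arXiv:1412.5842 — 6 statements merged into one kernel-verified Lean document; each statement's English description precedes it below -/
import Mathlib

section
/- Let d ≥ 2 and let w ∈ A_d^n be ℓ₁-periodic or almost ℓ₁-periodic. Let m ∈ {1,…,d−1} and k ∈ {1,…,n} with k ≤ n−ℓ₁ or k > ℓ₁. Then for any ℓ₂ with ℓ₂ < n/2, ℓ₂ ≤ ℓ₁, and n ≥ ℓ₁ + ℓ₂, the string w^{(k,m)} is not ℓ₂-periodic. -/
/- Common framework: the directed de Bruijn graph B⃗(d,n).
Vertices are strings of length `n` over the alphabet `A_d = Fin d`,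
modelled as functions `Fin n → Fin d` (0-indexed; the paper's 1-indexed
position `i` corresponds to index `i - 1` here). -/

namespace DeBruijnPaper

/-- Vertices of the directed de Bruijn graph: strings of length `n` over `Fin d`. -/
abbrev Vtx (d n : ℕ) := Fin n → Fin d

/-- Directed edge from `x = x₁⋯xₙ` to `y = y₁⋯yₙ`:
`x₂x₃⋯xₙ = y₁y₂⋯y_{n−1}`. -/
def adj (d n : ℕ) (x y : Vtx d n) : Prop :=
  ∀ (i : ℕ) (h : i + 1 < n), x ⟨i + 1, h⟩ = y ⟨i, by omega⟩

/-- There is a directed walk of length `t` from `x` to `y`. -/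
def hasWalk (d n : ℕ) (t : ℕ) (x y : Vtx d n) : Prop :=
  ∃ f : ℕ → Vtx d n, f 0 = x ∧ f t = y ∧ ∀ i < t, adj d n (f i) (f (i + 1))

/-- Directed distance `d⃗(x,y)`: the length of a shortest directed path
(equivalently walk) from `x` to `y`. -/
noncomputable def dirDist (d n : ℕ) (x y : Vtx d n) : ℕ :=
  sInf {t : ℕ | hasWalk d n t x y}

/-- The in-ball `B_t^−(v) = {u : d⃗(u,v) ≤ t}`. -/
def inBall (d n t : ℕ) (v : Vtx d n) : Set (Vtx d n) :=
  {u : Vtx d n | dirDist d n u v ≤ t}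

/-- `S` is a `t`-identifying code: every vertex has a nonempty identifying set
`B_t^−(v) ∩ S`, and distinct vertices have distinct identifying sets. -/
def IsIdCode (d n t : ℕ) (S : Set (Vtx d n)) : Prop :=
  (∀ v : Vtx d n, (inBall d n t v ∩ S).Nonempty) ∧
    ∀ u v : Vtx d n, u ≠ v → inBall d n t u ∩ S ≠ inBall d n t v ∩ S

/-- `S` is a (directed) `t`-dominating set. -/
def IsDomSet (d n t : ℕ) (S : Set (Vtx d n)) : Prop :=
  ∀ v : Vtx d n, (inBall d n t v ∩ S).Nonempty

/-- `S` is a directed resolving set. -/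
def IsResolving (d n : ℕ) (S : Set (Vtx d n)) : Prop :=
  ∀ u v : Vtx d n, u ≠ v → ∃ s ∈ S, dirDist d n s u ≠ dirDist d n s v

/-- The directed metric dimension: minimum size of a directed resolving set. -/
noncomputable def metricDim (d n : ℕ) : ℕ :=
  sInf {k : ℕ | ∃ S : Set (Vtx d n), IsResolving d n S ∧ S.ncard = k}

/-- `π` is an automorphism of the directed de Bruijn graph. -/
def IsAut (d n : ℕ) (π : Equiv.Perm (Vtx d n)) : Prop :=
  ∀ x y : Vtx d n, adj d n x y ↔ adj d n (π x) (π y)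

/-- `S` is a determining set. -/
def IsDetSet (d n : ℕ) (S : Set (Vtx d n)) : Prop :=
  ∀ π : Equiv.Perm (Vtx d n), IsAut d n π → (∀ s ∈ S, π s = s) → π = 1

/-- The determining number: minimum size of a determining set. -/
noncomputable def detNum (d n : ℕ) : ℕ :=
  sInf {k : ℕ | ∃ S : Set (Vtx d n), IsDetSet d n S ∧ S.ncard = k}

/-- `w` (of length `N`) has period length `ℓ` (a positive period is intended):
`N ≥ 2ℓ` and `w_i = w_{i+ℓ}` for all valid `i` (paper is 1-indexed, here 0-indexed). -/
def HasPeriod {d N : ℕ} (w : Fin N → Fin d) (ℓ : ℕ) : Prop :=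
  2 * ℓ ≤ N ∧ ∀ (i : ℕ) (h : i + ℓ < N), w ⟨i, by omega⟩ = w ⟨i + ℓ, h⟩

/-- `w` is `ℓ`-periodic: it has period length `ℓ` but no (positive) period length `k < ℓ`. -/
def IsPeriodic {d N : ℕ} (w : Fin N → Fin d) (ℓ : ℕ) : Prop :=
  HasPeriod w ℓ ∧ ∀ k : ℕ, 1 ≤ k → k < ℓ → ¬ HasPeriod w k

/-- `w` is almost `ℓ`-periodic: `ℓ > N/2` and some extension `w ⊕ w'` of length `2ℓ`
is `ℓ`-periodic. -/
def AlmostPeriodic {d N : ℕ} (w : Fin N → Fin d) (ℓ : ℕ) : Prop :=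
  N < 2 * ℓ ∧ ∃ w' : Fin (2 * ℓ - N) → Fin d, IsPeriodic (Fin.append w w') ℓ

/-- `w^{(k,m)}` where `k` is the 0-indexed position: add `m` (mod `d`) to the `k`-th letter.
(The paper's 1-indexed `w^{(k,m)}` is `modify w (k-1) m` here.) -/
def modify {d N : ℕ} (w : Fin N → Fin d) (k : ℕ) (m : Fin d) : Fin N → Fin d :=
  fun i => if i.val = k then w i + m else w i

/-- `w(a:b)`: the substring `w_a w_{a+1} ⋯ w_b`, with `a`, `b` 1-indexed as in the paper. -/
def substr {d N : ℕ} (w : Fin N → Fin d) (a b : ℕ) (ha : 1 ≤ a) (hb : b ≤ N) :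
    Fin (b + 1 - a) → Fin d :=
  fun i => w ⟨a - 1 + i.val, by have := i.isLt; omega⟩

/-- Let `f` be a word of length `a + b` with period `b` that satisfies `f x = f (x + a)` for all
`x < b` except possibly `x = q`. Then it satisfies this for `x = q` as well, because the pairs
`{x, x + a}` and `{x, x + b}` form disjoint cycles. -/
theorem eq_add_of_forall_ne {α : Type*} (f : ℕ → α) {a b q : ℕ} (hq : q < b)
    (hb : ∀ x < a, f x = f (x + b)) (ha : ∀ x < b, x ≠ q → f x = f (x + a)) :
    f q = f (q + a) := by
  have hqN : q % (a + b) = q := Nat.mod_eq_of_lt (by omega)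
  have step : ∀ x < a + b, x ≠ q → f ((x + a) % (a + b)) = f x := by
    intro x hx hxq
    by_cases hxb : x < b
    · rw [Nat.mod_eq_of_lt (by omega), ← ha x hxb hxq]
    · rw [show x + a = (x - b) + (a + b) by omega, Nat.add_mod_right,
        Nat.mod_eq_of_lt (by omega), hb (x - b) (by omega), Nat.sub_add_cancel (by omega)]
  have walk : ∀ t : ℕ, f ((q + (t + 1) * a) % (a + b)) = f (q + a) ∨ f q = f (q + a) := by
    intro t
    induction t with
    | zero => left; rw [zero_add, one_mul, Nat.mod_eq_of_lt (by omega)]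
    | succ t ih =>
      rcases ih with ih | ih
      · by_cases hx : (q + (t + 1) * a) % (a + b) = q
        · right; rwa [hx] at ih
        · left
          rw [← ih, ← step _ (Nat.mod_lt _ (by omega)) hx, Nat.mod_add_mod]
          congr 2; ring
      · exact Or.inr ih
  rcases walk (a + b - 1) with h | h
  · rwa [Nat.sub_add_cancel (by omega), Nat.add_mul_mod_self_left, hqN] at h
  · exact h

/-- A periodic or almost periodic word agrees with its shift by the period. -/
theorem eq_shift_of_isPeriodic_or_almostPeriodic {d n ℓ : ℕ} {w : Fin n → Fin d}
    (hw : IsPeriodic w ℓ ∨ AlmostPeriodic w ℓ) (i : ℕ) (h : i + ℓ < n) :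
    w ⟨i, by omega⟩ = w ⟨i + ℓ, h⟩ := by
  rcases hw with hw | ⟨_, w', hw⟩
  · exact hw.1.2 i h
  · have happ : ∀ (j : ℕ) (hj : j < n), Fin.append w w' ⟨j, by omega⟩ = w ⟨j, hj⟩ :=
      fun j hj => Fin.append_left w w' ⟨j, hj⟩
    rw [← happ, ← happ]
    exact hw.1.2 i (by omega)

/-- Adding a nonzero letter changes the letter. -/
theorem add_ne_self_of_one_le {d : ℕ} (x m : Fin d) (hm : 1 ≤ m.val) : x + m ≠ x := by
  have : NeZero d := ⟨by have := x.isLt; omega⟩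
  intro h
  rw [add_eq_left] at h
  simp [h] at hm

/-- If `w` agrees with its shift by `a` and the word obtained by modifying position `K` agrees
with its shift by `b`, then `K` does not belong to any pair `{Q, Q + a}` of positions. -/
theorem not_shift_modify {d n a b K Q : ℕ} {w : Fin n → Fin d} {m : Fin d} (hm : 1 ≤ m.val)
    (hb : 1 ≤ b) (hba : b ≤ a) (hn : a + b ≤ n) (hQ : Q + a < n) (hK : K = Q ∨ K = Q + a)
    (hw : ∀ (i : ℕ) (h : i + a < n), w ⟨i, by omega⟩ = w ⟨i + a, h⟩) :
    ¬ ∀ (i : ℕ) (h : i + b < n), modify w K m ⟨i, by omega⟩ = modify w K m ⟨i + b, h⟩ := by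
  intro hu
  obtain ⟨s, q, hs, rfl, hq⟩ : ∃ s q, s + a + b ≤ n ∧ Q = s + q ∧ q < b :=
    ⟨min Q (n - a - b), Q - min Q (n - a - b), by omega, by omega, by omega⟩
  let f : ℕ → Fin d := fun x => if h : s + x < n then modify w K m ⟨s + x, h⟩ else m
  have hf : ∀ x (h : s + x < n), f x = modify w K m ⟨s + x, h⟩ := fun x h => dif_pos h
  have key : f q = f (q + a) := by
    refine eq_add_of_forall_ne f hq (fun x hx => ?_) (fun x hx hxq => ?_)
    · rw [hf x (by omega), hf (x + b) (by omega)]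
      simpa only [add_assoc] using hu (s + x) (by omega)
    · rw [hf x (by omega), hf (x + a) (by omega)]
      simp only [modify]
      rw [if_neg (by omega), if_neg (by omega)]
      simpa only [add_assoc] using hw (s + x) (by omega)
  rw [hf q (by omega), hf (q + a) (by omega)] at key
  have hwq : w ⟨s + q, by omega⟩ = w ⟨s + (q + a), by omega⟩ := by
    simpa only [add_assoc] using hw (s + q) hQ
  simp only [modify] at key
  rcases hK with rfl | rfl
  · rw [if_pos rfl, if_neg (by omega), ← hwq] at key
    exact add_ne_self_of_one_le _ m hm key
  · rw [if_neg (by omega), if_pos (by omega), ← hwq] at key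
    exact add_ne_self_of_one_le _ m hm key.symm

/-- Lemma `MPL3`: if `w` is `ℓ₁`-periodic or almost `ℓ₁`-periodic,
`m ∈ {1,…,d−1}`, `k ∈ {1,…,n}` (1-indexed) with `k ≤ n − ℓ₁` or `k > ℓ₁`, then for any
(positive) `ℓ₂ < n/2` with `ℓ₂ ≤ ℓ₁` and `n ≥ ℓ₁ + ℓ₂`, `w^{(k,m)}` is not `ℓ₂`-periodic. -/
theorem stmt14 (d n ℓ₁ ℓ₂ : ℕ) (hd : 2 ≤ d) (w : Fin n → Fin d)
    (hw : IsPeriodic w ℓ₁ ∨ AlmostPeriodic w ℓ₁)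
    (m : Fin d) (hm : 1 ≤ m.val)
    (k : ℕ) (hk1 : 1 ≤ k) (hk2 : k ≤ n)
    (hk : k ≤ n - ℓ₁ ∨ ℓ₁ < k)
    (hℓ₂ : 1 ≤ ℓ₂) (h2 : 2 * ℓ₂ < n) (h3 : ℓ₂ ≤ ℓ₁) (h4 : ℓ₁ + ℓ₂ ≤ n) :
    ¬ IsPeriodic (modify w (k - 1) m) ℓ₂ := by
  rintro ⟨⟨_, hu⟩, _⟩
  obtain ⟨Q, hQ, hK⟩ : ∃ Q, Q + ℓ₁ < n ∧ (k - 1 = Q ∨ k - 1 = Q + ℓ₁) := by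
    rcases hk with hk | hk
    · exact ⟨k - 1, by omega, Or.inl rfl⟩
    · exact ⟨k - 1 - ℓ₁, by omega, Or.inr (by omega)⟩
  exact not_shift_modify hm hℓ₂ h3 h4 hQ hK (eq_shift_of_isPeriodic_or_almostPeriodic hw) hu

end DeBruijnPaper
end

section
/- Let d ≥ 2 and let w ∈ A_d^n have period length ℓ₁ for some ℓ₁ < n/2. Then for all m ∈ {1,…,d−1}, for all i, j, k ∈ {1,…,n} with i ≤ k ≤ j, and for all ℓ₂ ≤ ℓ₁ with j−i+1 ≥ ℓ₁ + ℓ₂ and with either k ≥ i+ℓ₁ or k ≤ j−ℓ₁, the substring w^{(k,m)}(i : j) does not have period length ℓ₂. -/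
/- Common framework: the directed de Bruijn graph B⃗(d,n).
Vertices are strings of length `n` over the alphabet `A_d = Fin d`,
modelled as functions `Fin n → Fin d` (0-indexed; the paper's 1-indexed
position `i` corresponds to index `i - 1` here). -/

namespace DeBruijnPaper

/-- If `v` is invariant under the shift by `b` on `[0, a + b)`, and under the shift by `a`
except possibly at `p`, then it is also invariant at `p`: the shifts form the cycles of
`x ↦ x + b` modulo `a + b`, and a cycle stays connected when one edge is removed. -/
theorem eq_shift_of_eq_shift_of_ne {α : Type*} {a b p : ℕ} (v : ℕ → α) (hp : p < b)
    (hb : ∀ x < a, v x = v (x + b)) (ha : ∀ x < b, x ≠ p → v x = v (x + a)) :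
    v p = v (p + a) := by
  by_contra hne
  have key : ∀ t : ℕ, v ((p + t * b) % (a + b)) = v p := by
    intro t
    induction t with
    | zero => rw [Nat.zero_mul, Nat.add_zero, Nat.mod_eq_of_lt (by omega)]
    | succ t ih =>
      have hlt : (p + t * b) % (a + b) < a + b := Nat.mod_lt _ (by omega)
      have hstep : (p + (t + 1) * b) % (a + b) = ((p + t * b) % (a + b) + b) % (a + b) := by
        rw [Nat.mod_add_mod, Nat.add_mul, Nat.one_mul, Nat.add_assoc]
      rw [hstep]
      generalize (p + t * b) % (a + b) = q at ih hlt
      by_cases hq : q < a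
      · rw [Nat.mod_eq_of_lt (by omega), ← hb q hq, ih]
      · obtain ⟨x, rfl⟩ := Nat.exists_eq_add_of_le' (not_lt.mp hq)
        rw [Nat.add_assoc, Nat.add_mod_right, Nat.mod_eq_of_lt (by omega)]
        by_cases hx : x = p
        · rw [hx]
        · rw [ha x (by omega) hx, ih]
  refine hne ?_
  have hlast : (p + (a + b - 1) * b) % (a + b) = p + a := by
    obtain ⟨c, rfl⟩ := Nat.exists_eq_add_of_lt (Nat.zero_lt_of_lt hp)
    have h : p + (a + (0 + c + 1) - 1) * (0 + c + 1) = p + a + c * (a + (0 + c + 1)) := by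
      rw [show a + (0 + c + 1) - 1 = a + c by omega]
      ring
    rw [h, Nat.add_mul_mod_self_right, Nat.mod_eq_of_lt (by omega)]
  rw [← key (a + b - 1), hlast]

/-- Lemma `L2.16`: if `w` has period length `ℓ₁ < n/2`, then for all
`m ∈ {1,…,d−1}`, all 1-indexed `i ≤ k ≤ j` in `{1,…,n}`, and all positive `ℓ₂ ≤ ℓ₁`
with `j − i + 1 ≥ ℓ₁ + ℓ₂` and `k ≥ i + ℓ₁` or `k ≤ j − ℓ₁`, the substring
`w^{(k,m)}(i:j)` does not have period length `ℓ₂`. -/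
theorem stmt15 (d n ℓ₁ ℓ₂ : ℕ) (hd : 2 ≤ d) (w : Fin n → Fin d)
    (hℓ₁ : 1 ≤ ℓ₁) (hn : 2 * ℓ₁ < n) (hw : HasPeriod w ℓ₁)
    (m : Fin d) (hm : 1 ≤ m.val)
    (i j k : ℕ) (hi : 1 ≤ i) (hj : j ≤ n) (hik : i ≤ k) (hkj : k ≤ j)
    (hℓ₂ : 1 ≤ ℓ₂) (hℓ : ℓ₂ ≤ ℓ₁) (hlen : ℓ₁ + ℓ₂ ≤ j - i + 1)
    (hpos : i + ℓ₁ ≤ k ∨ k ≤ j - ℓ₁) :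
    ¬ HasPeriod (substr (modify w (k - 1) m) i j hi hj) ℓ₂ := by
  rintro ⟨-, hper⟩
  have hw := hw.2
  have hmod : ∀ x : Fin d, x ≠ x + m := by
    obtain ⟨e, rfl⟩ : ∃ e, d = e + 1 := ⟨d - 1, by omega⟩
    intro x hx
    have : m = 0 := left_eq_add.mp hx
    simp [this] at hm
  let u : ℕ → Fin d := fun x => if h : x < n then modify w (k - 1) m ⟨x, h⟩ else m
  have hu : ∀ x (h : x < n), u x = if x = k - 1 then w ⟨x, h⟩ + m else w ⟨x, h⟩ := by
    intro x h
    simp [u, h, modify]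
  have hshift : ∀ x, i - 1 ≤ x → x + ℓ₂ < j → u x = u (x + ℓ₂) := by
    intro x hx hxj
    have h := hper (x - (i - 1)) (by omega)
    have e₁ : i - 1 + (x - (i - 1)) = x := by omega
    have e₂ : i - 1 + (x - (i - 1) + ℓ₂) = x + ℓ₂ := by omega
    simp only [substr, e₁, e₂] at h
    simpa only [u, dif_pos (show x < n by omega), dif_pos (show x + ℓ₂ < n by omega)] using h
  have hwindow : ∀ s p, i - 1 ≤ s → s + (ℓ₁ + ℓ₂) ≤ j → p < ℓ₂ →
      (s + p = k - 1 ∨ s + p + ℓ₁ = k - 1) → False := by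
    intro s p hs hsj hp hk
    have h := eq_shift_of_eq_shift_of_ne (a := ℓ₁) (fun x => u (s + x)) hp
      (fun x hx => by
        simpa only [Nat.add_assoc] using hshift (s + x) (by omega) (by omega)) (fun x hx hxp => by
        simp only [← Nat.add_assoc]
        rw [hu _ (by omega), hu _ (by omega), if_neg (by omega), if_neg (by omega)]
        exact hw _ _)
    simp only [← Nat.add_assoc] at h
    rw [hu _ (by omega), hu _ (by omega), ← hw (s + p) (by omega)] at h
    rcases hk with hk | hk
    · rw [if_pos hk, if_neg (by omega)] at h
      exact hmod _ h.symm
    · rw [if_neg (by omega), if_pos hk] at h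
      exact hmod _ h
  rcases hpos with hpos | hpos
  · exact hwindow (min (k - 1 - ℓ₁) (j - (ℓ₁ + ℓ₂)))
      (k - 1 - ℓ₁ - min (k - 1 - ℓ₁) (j - (ℓ₁ + ℓ₂)))
      (by omega) (by omega) (by omega) (by omega)
  · exact hwindow (min (k - 1) (j - (ℓ₁ + ℓ₂))) (k - 1 - min (k - 1) (j - (ℓ₁ + ℓ₂)))
      (by omega) (by omega) (by omega) (by omega)

end DeBruijnPaper
end

section
/- Let d ≥ 2, n = 2t with t ≥ 1, and let u ∈ A_d^n have period length t. If for some ℓ with 1 ≤ ℓ < t and some m ∈ A_d, the string u′ = u^{(t,m)}(t+1−ℓ : n−1) is ℓ-periodic, then ℓ divides t and the string u′ ⊕ (u_n + m mod d) has period length ℓ. -/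
/- Common framework: the directed de Bruijn graph B⃗(d,n).
Vertices are strings of length `n` over the alphabet `A_d = Fin d`,
modelled as functions `Fin n → Fin d` (0-indexed; the paper's 1-indexed
position `i` corresponds to index `i - 1` here). -/

namespace DeBruijnPaper

/-- Self-overlap of a list of values, expressed by indices of the underlying string. -/
theorem list_ofFn_hasPeriod_iff {α : Type*} {N : ℕ} (w : Fin N → α) (p : ℕ) :
    (List.ofFn w).HasPeriod p ↔
      ∀ (i : ℕ) (h : i + p < N), w ⟨i, by omega⟩ = w ⟨i + p, h⟩ := by
  rw [List.hasPeriod_iff_getElem?]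
  simp only [List.length_ofFn, List.getElem?_ofFn]
  constructor
  · intro H i h
    have := H i (by omega)
    rwa [dif_pos (by omega), dif_pos h, Option.some_inj] at this
  · intro H i h
    rw [dif_pos (by omega), dif_pos (by omega), H i (by omega)]

/-- A string repeats along every multiple of one of its period lengths. -/
theorem HasPeriod.apply_add_mul {d N ℓ : ℕ} {w : Fin N → Fin d} (hw : HasPeriod w ℓ)
    (i k : ℕ) (h : i + ℓ * k < N) :
    w ⟨i, lt_of_le_of_lt (Nat.le_add_right _ _) h⟩ = w ⟨i + ℓ * k, h⟩ := by
  induction k with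
  | zero => rfl
  | succ k ih =>
    rw [Nat.mul_succ, ← Nat.add_assoc] at h
    rw [ih (by omega), hw.2 _ h]
    simp only [Nat.mul_succ, Nat.add_assoc]

/-- If an `ℓ`-periodic string of length at least `ℓ + t - 1` agrees with its shift by `t`,
then `ℓ` divides `t`. -/
theorem IsPeriodic.dvd_of_shift {d N ℓ t : ℕ} {w : Fin N → Fin d} (hw : IsPeriodic w ℓ)
    (hℓ : 1 ≤ ℓ) (hN : ℓ + t ≤ N + 1)
    (hshift : ∀ (i : ℕ) (h : i + t < N), w ⟨i, by omega⟩ = w ⟨i + t, h⟩) : ℓ ∣ t := by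
  have hpos : 0 < ℓ.gcd t := Nat.gcd_pos_of_pos_left t hℓ
  have hle : ℓ.gcd t ≤ ℓ := Nat.gcd_le_left t hℓ
  have hgcd : (List.ofFn w).HasPeriod (ℓ.gcd t) :=
    ((list_ofFn_hasPeriod_iff w ℓ).2 hw.1.2).gcd ((list_ofFn_hasPeriod_iff w t).2 hshift)
      (by rw [List.length_ofFn]; omega)
  have hN2 := hw.1.1
  by_contra hdvd
  exact hw.2 _ hpos (lt_of_le_of_ne hle fun h => hdvd (Nat.gcd_eq_left_iff_dvd.1 h))
    ⟨by omega, (list_ofFn_hasPeriod_iff w _).1 hgcd⟩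

/-- Appending the letter found `ℓ` places before the end preserves the period length `ℓ`. -/
theorem HasPeriod.snoc {d N ℓ : ℕ} {w : Fin N → Fin d} (hw : HasPeriod w ℓ) {a : Fin d}
    (ha : ∀ (i : ℕ) (h : i < N), i + ℓ = N → w ⟨i, h⟩ = a) (hℓ : 1 ≤ ℓ) :
    HasPeriod (Fin.snoc w a : Fin (N + 1) → Fin d) ℓ := by
  refine ⟨by have := hw.1; omega, fun i h => ?_⟩
  have hi : i < N := by omega
  rcases Nat.lt_or_ge (i + ℓ) N with h' | h'
  · simpa [Fin.snoc, hi, h'] using hw.2 i h'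
  · simpa [Fin.snoc, hi, Nat.not_lt.2 h'] using ha i hi (by omega)

/-- Lemma `L8`: let `n = 2t` and let `u` have period length `t`.  If for
some `1 ≤ ℓ < t` and `m ∈ A_d` the string `u′ = u^{(t,m)}(t+1−ℓ : n−1)` is `ℓ`-periodic,
then `ℓ ∣ t` and `u′ ⊕ (u_n + m)` has period length `ℓ`. -/
theorem stmt16 (d t : ℕ) (hd : 2 ≤ d) (ht : 1 ≤ t) (u : Fin (2 * t) → Fin d)
    (hu : HasPeriod u t) (ℓ : ℕ) (hℓ1 : 1 ≤ ℓ) (hℓt : ℓ < t) (m : Fin d)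
    (hper : IsPeriodic
      (substr (modify u (t - 1) m) (t + 1 - ℓ) (2 * t - 1) (by omega) (by omega)) ℓ) :
    ℓ ∣ t ∧
    HasPeriod
      (Fin.snoc
        (substr (modify u (t - 1) m) (t + 1 - ℓ) (2 * t - 1) (by omega) (by omega))
        (u ⟨2 * t - 1, by omega⟩ + m)) ℓ := by
  set w := substr (modify u (t - 1) m) (t + 1 - ℓ) (2 * t - 1) (by omega) (by omega) with hw
  have hshift : ∀ (i : ℕ) (h : i + t < 2 * t - 1 + 1 - (t + 1 - ℓ)),
      w ⟨i, by omega⟩ = w ⟨i + t, h⟩ := by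
    intro i h
    have h1 : t + 1 - ℓ - 1 + i ≠ t - 1 := by omega
    have h2 : t + 1 - ℓ - 1 + (i + t) ≠ t - 1 := by omega
    simp only [hw, substr, modify, if_neg h1, if_neg h2]
    rw [hu.2 _ (by omega)]
    simp only [Nat.add_assoc]
  have hdvd : ℓ ∣ t := hper.dvd_of_shift hℓ1 (by omega) hshift
  refine ⟨hdvd, hper.1.snoc (fun i h hi => ?_) hℓ1⟩
  obtain ⟨k, rfl⟩ := hdvd
  obtain ⟨k, rfl⟩ : ∃ j, k = j + 1 :=
    Nat.exists_eq_succ_of_ne_zero (by rintro rfl; simp at ht)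
  have hmul : ℓ * (k + 1) = ℓ * k + ℓ := Nat.mul_succ ℓ k
  have hidx : i = ℓ - 1 + ℓ * k := by omega
  subst hidx
  rw [← hper.1.apply_add_mul (ℓ - 1) k h]
  have h1 : ℓ * (k + 1) + 1 - ℓ - 1 + (ℓ - 1) = ℓ * (k + 1) - 1 := by omega
  have h2 : ℓ * (k + 1) - 1 + ℓ * (k + 1) = 2 * (ℓ * (k + 1)) - 1 := by omega
  simp only [hw, substr, modify, h1, if_true]
  rw [hu.2 _ (by omega)]
  simp only [h2]

end DeBruijnPaper
end

section
/- For every d ≥ 2, the set S = {aa : a ∈ A_d} of the d constant strings of length 2 is a determining set for the directed de Bruijn graph B⃗(d,2): the only automorphism of B⃗(d,2) fixing every element of S is the identity. -/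
/- Common framework: the directed de Bruijn graph B⃗(d,n).
Vertices are strings of length `n` over the alphabet `A_d = Fin d`,
modelled as functions `Fin n → Fin d` (0-indexed; the paper's 1-indexed
position `i` corresponds to index `i - 1` here). -/

namespace DeBruijnPaper

theorem adj_two_iff {d : ℕ} {x y : Vtx d 2} : adj d 2 x y ↔ x 1 = y 0 := by
  refine ⟨fun h => h 0 (by omega), fun h i hi => ?_⟩
  obtain rfl : i = 0 := by omega
  exact h

/-- the set of the `d` constant strings of length 2 is a determining set
for `B⃗(d,2)`. -/
theorem stmt17 (d : ℕ) (hd : 2 ≤ d) :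
    IsDetSet d 2 {w : Vtx d 2 | ∃ a : Fin d, w = fun _ => a} := by
  intro π hπ hfix
  have hconst (a : Fin d) : π (fun _ => a) = fun _ => a := hfix _ ⟨a, rfl⟩
  ext1 x
  have h₀ := (hπ (fun _ => x 0) x).1 (adj_two_iff.2 rfl)
  have h₁ := (hπ x (fun _ => x 1)).1 (adj_two_iff.2 rfl)
  rw [hconst, adj_two_iff] at h₀ h₁
  funext i
  fin_cases i
  · exact h₀.symm
  · exact h₁

end DeBruijnPaper
end

section
/- For all d ≥ 2 and n ≥ 2, every automorphism of the directed de Bruijn graph B⃗(d,n) is given by applying a permutation σ of the alphabet A_d coordinatewise (x₁x₂⋯xₙ ↦ σ(x₁)σ(x₂)⋯σ(xₙ)), and the map sending σ to this coordinatewise action is a group isomorphism from the symmetric group Sym(A_d) onto Aut(B⃗(d,n)). -/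
/- Common framework: the directed de Bruijn graph B⃗(d,n).
Vertices are strings of length `n` over the alphabet `A_d = Fin d`,
modelled as functions `Fin n → Fin d` (0-indexed; the paper's 1-indexed
position `i` corresponds to index `i - 1` here). -/

namespace DeBruijnPaper

namespace IsAut

variable {d n : ℕ} {π : Equiv.Perm (Vtx d n)}

/-- Automorphisms preserve agreement of two strings on any terminal segment. -/
theorem agree_suffix (hπ : IsAut d n π) {t : ℕ} (ht : t < n) {x y : Vtx d n}
    (h : ∀ i : Fin n, t ≤ i.val → x i = y i) (i : Fin n) (hi : t ≤ i.val) :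
    π x i = π y i := by
  induction t generalizing x y i with
  | zero =>
    have hxy : x = y := funext fun j => h j j.val.zero_le
    rw [hxy]
  | succ t ih =>
    let shift (z : Vtx d n) : Vtx d n :=
      fun j => if hj : j.val + 1 < n then z ⟨j.val + 1, hj⟩ else x i
    have adj_shift (z : Vtx d n) : adj d n z (shift z) := fun j hj => by
      simp [shift, hj]
    have hshift : ∀ j : Fin n, t ≤ j.val → shift x j = shift y j := by
      intro j hj
      by_cases hjn : j.val + 1 < n
      · simpa [shift, hjn] using h ⟨j.val + 1, hjn⟩ (Nat.succ_le_succ hj)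
      · simp [shift, hjn]
    obtain ⟨_ | j, hjn⟩ := i
    · simp at hi
    · have hx := (hπ _ _).1 (adj_shift x) j hjn
      have hy := (hπ _ _).1 (adj_shift y) j hjn
      rw [hx, hy]
      exact ih (by omega) hshift _ (Nat.le_of_succ_le_succ hi)

/-- An automorphism acts on every coordinate by the map through which it acts on the last
letter of the constant strings. -/
theorem apply_eq (hπ : IsAut d n π) (hn : n - 1 < n) (x : Vtx d n) (i : Fin n) :
    π x i = π (fun _ => x i) ⟨n - 1, hn⟩ := by
  obtain ⟨k, hk⟩ : ∃ k, i.val + k = n - 1 := ⟨n - 1 - i.val, by omega⟩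
  induction k generalizing x i with
  | zero =>
    obtain rfl : i = ⟨n - 1, hn⟩ := Fin.ext hk
    refine hπ.agree_suffix hn (fun j hj => ?_) _ le_rfl
    congr 1
    ext
    dsimp at hj ⊢
    omega
  | succ k ih =>
    let y : Vtx d n := fun j => x ⟨j.val - 1, by omega⟩
    have hyx : adj d n y x := fun j hj => rfl
    have hin : i.val + 1 < n := by omega
    rw [← (hπ _ _).1 hyx i.val hin]
    exact ih y ⟨i.val + 1, hin⟩ (by dsimp; omega)

end IsAut

/-- every automorphism of `B⃗(d,n)` is the coordinatewise action of a
permutation of the alphabet, and `σ ↦ (coordinatewise action of σ)` is a group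
isomorphism from `Sym(A_d)` onto `Aut(B⃗(d,n))` (it lands in the automorphisms, is
surjective onto them, is injective, and preserves multiplication). -/
theorem stmt18 (d n : ℕ) (hd : 2 ≤ d) (hn : 2 ≤ n) :
    (∀ σ : Equiv.Perm (Fin d), IsAut d n ((Equiv.refl (Fin n)).arrowCongr σ)) ∧
    (∀ π : Equiv.Perm (Vtx d n), IsAut d n π →
      ∃ σ : Equiv.Perm (Fin d), π = (Equiv.refl (Fin n)).arrowCongr σ) ∧
    Function.Injective
      (fun σ : Equiv.Perm (Fin d) => (Equiv.refl (Fin n)).arrowCongr σ) ∧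
    (∀ σ τ : Equiv.Perm (Fin d),
      (Equiv.refl (Fin n)).arrowCongr (σ * τ) =
        ((Equiv.refl (Fin n)).arrowCongr σ) * ((Equiv.refl (Fin n)).arrowCongr τ)) := by
  have hlast : n - 1 < n := by omega
  refine ⟨fun σ x y => ?_, fun π hπ => ?_, fun σ τ h => ?_, fun σ τ => rfl⟩
  · simp [adj, Equiv.arrowCongr]
  · let s : Fin d → Fin d := fun a => π (fun _ => a) ⟨n - 1, hlast⟩
    have hs : Function.Injective s := by
      intro a b hab
      have hconst : π (fun _ => a) = π (fun _ => b) := funext fun i => by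
        rw [hπ.apply_eq hlast, hπ.apply_eq hlast (fun _ => b)]
        exact hab
      exact congrFun (π.injective hconst) ⟨n - 1, hlast⟩
    refine ⟨Equiv.ofBijective s (Finite.injective_iff_bijective.1 hs), ?_⟩
    ext1 x
    exact funext fun i => hπ.apply_eq hlast x i
  · ext1 a
    exact congrFun (DFunLike.congr_fun h (fun _ => a)) ⟨n - 1, hlast⟩

end DeBruijnPaper
end

section
/- For all d ≥ 2 and n ≥ 2, the determining number of the directed de Bruijn graph B⃗(d,n) is Det(B⃗(d,n)) = ⌈(d−1)/n⌉. -/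
/- Common framework: the directed de Bruijn graph B⃗(d,n).
Vertices are strings of length `n` over the alphabet `A_d = Fin d`,
modelled as functions `Fin n → Fin d` (0-indexed; the paper's 1-indexed
position `i` corresponds to index `i - 1` here). -/

namespace DeBruijnPaper

/-- `y` agrees with `x` shifted left by `t` places. -/
def ShiftAgree (d n t : ℕ) (x y : Vtx d n) : Prop :=
  ∀ (i : ℕ) (h : i + t < n), x ⟨i + t, h⟩ = y ⟨i, by omega⟩

theorem ShiftAgree.map {d n : ℕ} {π : Equiv.Perm (Vtx d n)} (hπ : IsAut d n π) (t : ℕ) :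
    ∀ {x y : Vtx d n}, t < n → ShiftAgree d n t x y → ShiftAgree d n t (π x) (π y) := by
  induction t with
  | zero =>
    intro x y _ h
    obtain rfl : x = y := funext fun i => h i i.2
    exact fun _ _ => rfl
  | succ t ih =>
    intro x y ht h
    let z : Vtx d n := fun i =>
      if hi : i.val + 1 < n then x ⟨i.val + 1, hi⟩ else y ⟨n - 1 - t, by omega⟩
    have hxz : adj d n x z := fun i hi => by simp [z, hi]
    have hzy : ShiftAgree d n t z y := by
      intro i hi
      by_cases hlt : i + t + 1 < n
      · simp only [z, hlt, dite_true]
        exact h i hlt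
      · obtain rfl : i = n - 1 - t := by omega
        simp [z, hlt]
    have h₁ := (hπ x z).1 hxz
    have h₂ := ih (by omega) hzy
    exact fun i hi => (h₁ (i + t) hi).trans (h₂ i (by omega))

/-- Every automorphism of a directed de Bruijn graph acts letterwise. -/
theorem IsAut.exists_letter_map {d n : ℕ} (hn : 0 < n) {π : Equiv.Perm (Vtx d n)}
    (hπ : IsAut d n π) : ∃ σ : Fin d → Fin d, ∀ x i, π x i = σ (x i) := by
  have last_eq_first (x y : Vtx d n) (h : x ⟨n - 1, by omega⟩ = y ⟨0, hn⟩) :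
      π x ⟨n - 1, by omega⟩ = π y ⟨0, hn⟩ := by
    have key : ShiftAgree d n (n - 1) x y := by
      intro i hi
      obtain rfl : i = 0 := by omega
      simpa using h
    simpa using ShiftAgree.map hπ (n - 1) (by omega) key 0 (by omega)
  refine ⟨fun a => π (fun _ => a) ⟨n - 1, by omega⟩, fun x i => ?_⟩
  let y : Vtx d n := fun j => if h : j.val + i.val < n then x ⟨j + i, h⟩ else x i
  have hxy : ShiftAgree d n i x y := fun j hj => by simp [y, hj]
  have h := ShiftAgree.map hπ i i.2 hxy 0 (by simp)
  have h' := last_eq_first (fun _ => x i) y (by simp [y])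
  simp only [zero_add] at h
  exact h.trans h'.symm

theorem isAut_arrowCongr {d n : ℕ} (σ : Equiv.Perm (Fin d)) :
    IsAut d n ((Equiv.refl (Fin n)).arrowCongr σ) := by
  intro x y
  simp [adj]

/-- Strings using all letters but possibly one form a determining set. -/
theorem isDetSet_of_letters {d n : ℕ} (hn : 0 < n) {S : Set (Vtx d n)} (b : Fin d)
    (hS : ∀ a, a ≠ b → ∃ s ∈ S, ∃ i, s i = a) : IsDetSet d n S := by
  intro π hπ hfix
  obtain ⟨σ, hσ⟩ := hπ.exists_letter_map hn
  have hσ_ne (a : Fin d) (ha : a ≠ b) : σ a = a := by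
    obtain ⟨s, hs, i, rfl⟩ := hS a ha
    rw [← hσ, hfix s hs]
  have hσ_inj : Function.Injective σ := by
    intro a c hac
    have : (fun _ => a : Vtx d n) = fun _ => c :=
      π.injective (funext fun i => by simp [hσ, hac])
    exact congrFun this ⟨0, hn⟩
  have hσ_id (a : Fin d) : σ a = a := by
    by_contra h
    have hab : a = b := by_contra fun hab => h (hσ_ne a hab)
    exact h (hσ_inj (hσ_ne (σ a) (hab ▸ h)))
  ext x i : 2
  simp [hσ, hσ_id]

theorem IsDetSet.eq_of_unused {d n : ℕ} (hn : 0 < n) {S : Set (Vtx d n)} (hS : IsDetSet d n S)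
    {a b : Fin d} (ha : ∀ s ∈ S, ∀ i, s i ≠ a) (hb : ∀ s ∈ S, ∀ i, s i ≠ b) : a = b := by
  have h := hS _ (isAut_arrowCongr (Equiv.swap a b)) fun s hs => funext fun i => by
    simpa using Equiv.swap_apply_of_ne_of_ne (ha s hs i) (hb s hs i)
  have h' := congrFun (congrArg (fun π => π (fun _ => a)) h) ⟨0, hn⟩
  simpa using h'.symm

theorem IsDetSet.le_ncard_mul {d n : ℕ} (hn : 0 < n) {S : Set (Vtx d n)} (hS : IsDetSet d n S) :
    d - 1 ≤ S.ncard * n := by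
  classical
  let L : Finset (Fin d) := (S.toFinite.toFinset ×ˢ Finset.univ).image fun p => p.1 p.2
  have hL : L.card ≤ S.ncard * n := by
    refine Finset.card_image_le.trans ?_
    simp [Set.ncard_eq_toFinset_card S]
  have hLc : Lᶜ.card ≤ 1 := by
    refine Finset.card_le_one.2 fun a ha b hb => ?_
    simp only [L, Finset.mem_compl, Finset.mem_image, not_exists, Finset.mem_product,
      Set.Finite.mem_toFinset, Finset.mem_univ, and_true, not_and, Prod.forall] at ha hb
    exact hS.eq_of_unused hn (fun s hs i => ha s i hs) (fun s hs i => hb s i hs)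
  have := L.card_add_card_compl
  rw [Fintype.card_fin] at this
  omega

theorem exists_isDetSet_ncard_le {d n k : ℕ} (hd : 0 < d) (hn : 0 < n) (hk : d - 1 ≤ k * n) :
    ∃ S : Set (Vtx d n), IsDetSet d n S ∧ S.ncard ≤ k := by
  let f : Fin k → Vtx d n := fun j i => ⟨min (n * j + i) (d - 1), by omega⟩
  refine ⟨Set.range f, isDetSet_of_letters hn ⟨d - 1, by omega⟩ fun a ha => ?_, ?_⟩
  · have ha' : a.val < d - 1 := by
      have := Fin.val_ne_of_ne ha
      simp only at this
      omega
    have hj : a.val / n < k := (Nat.div_lt_iff_lt_mul hn).2 (by omega)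
    refine ⟨_, ⟨⟨a.val / n, hj⟩, rfl⟩, ⟨a.val % n, Nat.mod_lt _ hn⟩, ?_⟩
    ext
    simp only [f, Nat.div_add_mod]
    omega
  · rw [← Nat.card_coe_set_eq]
    simpa using Finite.card_range_le f

/-- Corollary `cor:detnum`: the determining number of `B⃗(d,n)` is
`⌈(d−1)/n⌉`. -/
theorem stmt19 (d n : ℕ) (hd : 2 ≤ d) (hn : 2 ≤ n) :
    detNum d n = (d - 1 + n - 1) / n := by
  have hn' : 0 < n := by omega
  have ceil_le (m : ℕ) : (d - 1 + n - 1) / n ≤ m ↔ d - 1 ≤ m * n := by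
    rw [← Nat.lt_succ_iff, Nat.div_lt_iff_lt_mul hn', Nat.succ_mul]
    omega
  have lower (S : Set (Vtx d n)) (hS : IsDetSet d n S) : (d - 1 + n - 1) / n ≤ S.ncard :=
    (ceil_le _).2 (hS.le_ncard_mul hn')
  obtain ⟨S, hS, hcard⟩ :=
    exists_isDetSet_ncard_le (d := d) (by omega) hn' ((ceil_le _).1 le_rfl)
  apply le_antisymm
  · have hmem : S.ncard ∈ {k : ℕ | ∃ S : Set (Vtx d n), IsDetSet d n S ∧ S.ncard = k} :=
      ⟨S, hS, rfl⟩
    exact (Nat.sInf_le hmem).trans hcard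
  · refine le_csInf ⟨_, S, hS, rfl⟩ ?_
    rintro _ ⟨T, hT, rfl⟩
    exact lower T hT

end DeBruijnPaper
end
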